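/- Theorem (general method for local quadratic bounds, generic increments). Suppose R_{ij} : ℝ → ℝ ((i,j) ∈ V × V) are continuous τ-periodic functions that are identically zero when (i,j) ∉ E, and m_i : ℝ → ℝ (i ∈ V) are continuously differentiable τ-periodic functions with Σ_{i∈V} m_i(t) = 0 for all t, satisfying the continuity equation m_i'(t) + Σ_{j∈V} R_{ij}(t) − Σ_{j∈V} R_{ji}(t) = 0 for all i and t, together with the normalization (1/τ)∫₀^τ [Σ_{(i,j)∈V×V} α_{ij}(t)R_{ij}(t) + Σ_{i∈V} γ_i(t)m_i(t)] dt = y_{α,γ}. Then limsup_{y→y_{α,γ}, y≠y_{α,γ}} I_{α,γ}(y)/(y − y_{α,γ})² ≤ (1/(2 y_{α,γ}²)) · Σ_{(i,j)∈E} (1/τ)∫₀^τ (R_{ij}(t) − m_i(t)w_{ij}(t))² / 𝒬_{ij}(t) dt, where the limsup is taken in [0,∞]. -/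

import Mathlib

open MeasureTheory Filter
open scoped Topology ENNReal

/-- The function `Φ(q,p) = q log(q/p) − q + p` on `[0,∞) × [0,∞)` with values in `[0,∞]`,
with the conventions `Φ(0,p) = p` and `Φ(q,0) = ∞` for `q > 0`. -/
noncomputable def Phi (q p : ℝ) : ℝ≥0∞ :=
  if q = 0 then ENNReal.ofReal p
  else if p = 0 then ⊤
  else ENNReal.ofReal (q * Real.log (q / p) - q + p)

theorem Real.mul_log_div_sub_add_le {c p q : ℝ} (hc : 0 < c) (hp : c ≤ p) (hq : c ≤ q) :
    q * Real.log (q / p) - q + p ≤ (q - p) ^ 2 / (2 * c) := by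
  have hp0 : 0 < p := hc.trans_le hp
  have hq0 : 0 < q := hc.trans_le hq
  rcases le_total p q with h | h
  · have h1 : Real.log (q / p) ≤ (q / p - (q / p)⁻¹) / 2 := by
      rw [← Real.sinh_log (by positivity)]
      exact Real.self_le_sinh_iff.2 (Real.log_nonneg ((one_le_div hp0).2 h))
    have h2 : q * ((q / p - (q / p)⁻¹) / 2) - q + p = (q - p) ^ 2 / (2 * p) := by
      field_simp
      ring
    have h3 : (q - p) ^ 2 / (2 * p) ≤ (q - p) ^ 2 / (2 * c) := by gcongr
    nlinarith [mul_le_mul_of_nonneg_left h1 hq0.le]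
  · have h1 := Real.le_log_one_add_of_nonneg (x := p / q - 1) (by
      rw [sub_nonneg]
      exact (one_le_div hq0).2 h)
    have h2 : Real.log (q / p) = -Real.log (1 + (p / q - 1)) := by
      rw [← Real.log_inv, add_sub_cancel, inv_div]
    have h3 : 2 * (p / q - 1) / (p / q - 1 + 2) = 2 * (p - q) / (p + q) := by
      field_simp
      ring
    have h4 : (q - p) ^ 2 / (2 * q) ≤ (q - p) ^ 2 / (2 * c) := by gcongr
    have h5 : -(q * (2 * (p - q) / (p + q))) - q + p ≤ (q - p) ^ 2 / (2 * q) := by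
      have : (q - p) ^ 2 / (2 * q) - (-(q * (2 * (p - q) / (p + q))) - q + p)
          = (p - q) ^ 3 / (2 * q * (p + q)) := by
        field_simp
        ring
      have h6 : 0 ≤ (p - q) ^ 3 / (2 * q * (p + q)) := by
        have := sub_nonneg.2 h
        positivity
      linarith
    rw [h3] at h1
    rw [h2]
    nlinarith [mul_le_mul_of_nonneg_left h1 hq0.le]

theorem Phi_le_ofReal {c p q : ℝ} (hc : 0 < c) (hp : c ≤ p) (hq : c ≤ q) :
    Phi q p ≤ ENNReal.ofReal ((q - p) ^ 2 / (2 * c)) := by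
  rw [Phi, if_neg (hc.trans_le hq).ne', if_neg (hc.trans_le hp).ne']
  exact ENNReal.ofReal_le_ofReal (Real.mul_log_div_sub_add_le hc hp hq)

theorem Phi_perturb_le {a r s C ε : ℝ} (ha : 0 < a) (hr : |r| ≤ C * a) (hs : |s| ≤ C * a)
    (hε : C * |ε| < 1) :
    Phi (a + ε * r) (a + ε * s)
      ≤ ENNReal.ofReal (ε ^ 2 / (2 * (1 - C * |ε|)) * ((r - s) ^ 2 / a)) := by
  have key : ∀ x : ℝ, |x| ≤ C * a → a * (1 - C * |ε|) ≤ a + ε * x := fun x hx ↦ by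
    have h1 : |ε * x| ≤ |ε| * (C * a) := by
      rw [abs_mul]
      gcongr
    nlinarith [neg_abs_le (ε * x)]
  have hd : 0 < 1 - C * |ε| := sub_pos.2 hε
  convert Phi_le_ofReal (mul_pos ha hd) (key s hs) (key r hr) using 2
  field_simp
  ring

theorem Function.Periodic.exists_abs_le {f : ℝ → ℝ} {τ : ℝ} (hf : Function.Periodic f τ)
    (hτ : 0 < τ) (hc : Continuous f) : ∃ C, ∀ t, |f t| ≤ C := by
  obtain ⟨C, hC⟩ := (isCompact_Icc (a := (0 : ℝ)) (b := τ)).exists_bound_of_continuousOn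
    hc.continuousOn
  refine ⟨C, fun t ↦ ?_⟩
  obtain ⟨u, hu, hfu⟩ := hf.exists_mem_Ico₀ hτ t
  rw [hfu]
  exact hC u ⟨hu.1, hu.2.le⟩

theorem exists_uniform_abs_le_of_periodic {ι : Type*} [Finite ι] {f : ι → ℝ → ℝ} {τ : ℝ}
    (hτ : 0 < τ) (hf : ∀ i, Function.Periodic (f i) τ) (hc : ∀ i, Continuous (f i)) :
    ∃ C, ∀ i t, |f i t| ≤ C := by
  choose C hC using fun i ↦ (hf i).exists_abs_le hτ (hc i)
  obtain ⟨M, hM⟩ := Set.finite_range C |>.bddAbove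
  exact ⟨M, fun i t ↦ (hC i t).trans (hM ⟨i, rfl⟩)⟩

theorem stmt0
    {V : Type} [Fintype V] [Nonempty V]
    (E : Finset (V × V)) (hE : ∀ i : V, (i, i) ∉ E)
    (τ : ℝ) (hτ : 0 < τ)
    (w : V → V → ℝ → ℝ)
    (hw_cont : ∀ i j, Continuous (w i j))
    (hw_per : ∀ i j, Function.Periodic (w i j) τ)
    (hw_pos : ∀ i j, (i, j) ∈ E → ∀ t, 0 < w i j t)
    (hw_zero : ∀ i j, (i, j) ∉ E → ∀ t, w i j t = 0)
    (pi : V → ℝ → ℝ)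
    (hpi_diff : ∀ i, ContDiff ℝ 1 (pi i))
    (hpi_per : ∀ i, Function.Periodic (pi i) τ)
    (hpi_pos : ∀ i t, 0 < pi i t)
    (hpi_sum : ∀ t : ℝ, ∑ i, pi i t = 1)
    (hpi_cont_eq : ∀ i t, deriv (pi i) t
      + (∑ j, pi i t * w i j t) - (∑ j, pi j t * w j i t) = 0)
    (α : V → V → ℝ → ℝ)
    (hα_cont : ∀ i j, Continuous (α i j))
    (hα_per : ∀ i j, Function.Periodic (α i j) τ)
    (γ : V → ℝ → ℝ)
    (hγ_cont : ∀ i, Continuous (γ i))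
    (hγ_per : ∀ i, Function.Periodic (γ i) τ)
    (y0 : ℝ)
    (hy0 : y0 = (1 / τ) * (∫ t in (0:ℝ)..τ,
      ((∑ i, ∑ j, α i j t * (pi i t * w i j t)) + ∑ i, γ i t * pi i t)))
    (hy0_ne : y0 ≠ 0)
    (Iag : ℝ → ℝ≥0∞)
    (hI : ∀ y : ℝ, Iag y = sInf { c : ℝ≥0∞ |
      ∃ (Q : V → V → ℝ → ℝ) (ρ : V → ℝ → ℝ),
        (∀ i j, Continuous (Q i j)) ∧
        (∀ i j, Function.Periodic (Q i j) τ) ∧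
        (∀ i j t, 0 ≤ Q i j t) ∧
        (∀ i j, (i, j) ∉ E → ∀ t, Q i j t = 0) ∧
        (∀ i, ContDiff ℝ 1 (ρ i)) ∧
        (∀ i, Function.Periodic (ρ i) τ) ∧
        (∀ i t, 0 ≤ ρ i t) ∧
        (∀ t : ℝ, ∑ i, ρ i t = 1) ∧
        (∀ i t, deriv (ρ i) t + (∑ j, Q i j t) - (∑ j, Q j i t) = 0) ∧
        ((1 / τ) * (∫ t in (0:ℝ)..τ,
          ((∑ i, ∑ j, α i j t * Q i j t) + ∑ i, γ i t * ρ i t)) = y) ∧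
        c = ∑ e ∈ E, ENNReal.ofReal (1 / τ) *
          (∫⁻ t in Set.Ioc (0:ℝ) τ, Phi (Q e.1 e.2 t) (ρ e.1 t * w e.1 e.2 t)) })
    -- the legal input (R, m)
    (R : V → V → ℝ → ℝ)
    (hR_cont : ∀ i j, Continuous (R i j))
    (hR_per : ∀ i j, Function.Periodic (R i j) τ)
    (hR_zero : ∀ i j, (i, j) ∉ E → ∀ t, R i j t = 0)
    (m : V → ℝ → ℝ)
    (hm_diff : ∀ i, ContDiff ℝ 1 (m i))
    (hm_per : ∀ i, Function.Periodic (m i) τ)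
    (hm_sum : ∀ t : ℝ, ∑ i, m i t = 0)
    (hm_cont_eq : ∀ i t, deriv (m i) t + (∑ j, R i j t) - (∑ j, R j i t) = 0)
    (h_norm : (1 / τ) * (∫ t in (0:ℝ)..τ,
      ((∑ i, ∑ j, α i j t * R i j t) + ∑ i, γ i t * m i t)) = y0) :
    Filter.limsup (fun y : ℝ => Iag y / ENNReal.ofReal ((y - y0) ^ 2)) (𝓝[≠] y0)
      ≤ ENNReal.ofReal ((1 / (2 * y0 ^ 2)) *
          ∑ e ∈ E, (1 / τ) * (∫ t in (0:ℝ)..τ,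
            (R e.1 e.2 t - m e.1 t * w e.1 e.2 t) ^ 2 / (pi e.1 t * w e.1 e.2 t))) := by
  have hpic : ∀ i, Continuous (pi i) := fun i ↦ (hpi_diff i).continuous
  have hmc : ∀ i, Continuous (m i) := fun i ↦ (hm_diff i).continuous
  have ha : ∀ e ∈ E, ∀ t, 0 < pi e.1 t * w e.1 e.2 t := fun e he t ↦
    mul_pos (hpi_pos _ _) (hw_pos _ _ he t)
  -- uniform bounds on the relative size of the increments
  obtain ⟨C₁, hC₁⟩ := exists_uniform_abs_le_of_periodic hτ
    (f := fun (e : E) t ↦ R e.1.1 e.1.2 t / (pi e.1.1 t * w e.1.1 e.1.2 t))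
    (fun e t ↦ by simp only [hR_per _ _ t, hpi_per _ t, hw_per _ _ t])
    (fun e ↦ (hR_cont _ _).div ((hpic _).mul (hw_cont _ _)) fun t ↦ (ha e e.2 t).ne')
  obtain ⟨C₂, hC₂⟩ := exists_uniform_abs_le_of_periodic hτ
    (f := fun i t ↦ m i t / pi i t)
    (fun i t ↦ by simp only [hm_per _ t, hpi_per _ t])
    (fun i ↦ (hmc _).div (hpic _) fun t ↦ (hpi_pos i t).ne')
  set C := max C₁ C₂
  have hRC : ∀ e ∈ E, ∀ t, |R e.1 e.2 t| ≤ C * (pi e.1 t * w e.1 e.2 t) := fun e he t ↦ by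
    have h := (hC₁ ⟨e, he⟩ t).trans (le_max_left C₁ C₂)
    rwa [abs_div, abs_of_pos (ha e he t), div_le_iff₀ (ha e he t)] at h
  have hmC : ∀ i t, |m i t| ≤ C * pi i t := fun i t ↦ by
    have h := (hC₂ i t).trans (le_max_right C₁ C₂)
    rwa [abs_div, abs_of_pos (hpi_pos i t), div_le_iff₀ (hpi_pos i t)] at h
  have hmwC : ∀ e ∈ E, ∀ t, |m e.1 t * w e.1 e.2 t| ≤ C * (pi e.1 t * w e.1 e.2 t) :=
    fun e he t ↦ by
      rw [abs_mul, abs_of_pos (hw_pos _ _ he t), ← mul_assoc]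
      exact mul_le_mul_of_nonneg_right (hmC _ _) (hw_pos _ _ he t).le
  have hnonneg : ∀ {a x ε : ℝ}, 0 ≤ a → |x| ≤ C * a → C * |ε| < 1 → 0 ≤ a + ε * x := by
    intro a x ε h0 hx hε
    have h1 : |ε * x| ≤ |ε| * (C * a) := by
      rw [abs_mul]
      gcongr
    nlinarith [neg_abs_le (ε * x)]
  set g : V × V → ℝ → ℝ := fun e t ↦
    (R e.1 e.2 t - m e.1 t * w e.1 e.2 t) ^ 2 / (pi e.1 t * w e.1 e.2 t) with hg
  have hgc : ∀ e ∈ E, Continuous (g e) := fun e he ↦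
    (((hR_cont _ _).sub ((hmc _).mul (hw_cont _ _))).pow 2).div
      ((hpic _).mul (hw_cont _ _)) fun t ↦ (ha e he t).ne'
  have hg0 : ∀ e ∈ E, ∀ t, 0 ≤ g e t := fun e he t ↦ div_nonneg (sq_nonneg _) (ha e he t).le
  set S : ℝ := ∑ e ∈ E, (1 / τ) * ∫ t in (0:ℝ)..τ, g e t with hS
  -- the perturbed pair is admissible and its cost is at most quadratic
  have hbound : ∀ ε : ℝ, C * |ε| < 1 →
      Iag (y0 + ε * y0) ≤ ENNReal.ofReal (ε ^ 2 / (2 * (1 - C * |ε|)) * S) := by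
    intro ε hε
    have hd : 0 < 1 - C * |ε| := sub_pos.2 hε
    rw [hI]
    refine sInf_le_of_le ⟨fun i j t ↦ pi i t * w i j t + ε * R i j t,
      fun i t ↦ pi i t + ε * m i t, ?_, ?_, ?_, ?_, ?_, ?_, ?_, ?_, ?_, ?_, rfl⟩ ?_
    · exact fun i j ↦ ((hpic i).mul (hw_cont i j)).add (continuous_const.mul (hR_cont i j))
    · exact fun i j t ↦ by simp only [hR_per _ _ t, hpi_per _ t, hw_per _ _ t]
    · intro i j t
      by_cases he : (i, j) ∈ E
      · exact hnonneg (ha _ he t).le (hRC _ he t) hε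
      · simp [hw_zero i j he, hR_zero i j he]
    · intro i j he t
      simp [hw_zero i j he, hR_zero i j he]
    · exact fun i ↦ (hpi_diff i).add (contDiff_const.mul (hm_diff i))
    · exact fun i t ↦ by simp only [hm_per _ t, hpi_per _ t]
    · exact fun i t ↦ hnonneg (hpi_pos i t).le (hmC i t) hε
    · intro t
      rw [Finset.sum_add_distrib, ← Finset.mul_sum, hpi_sum, hm_sum]
      ring
    · intro i t
      have h1 : deriv (fun t ↦ pi i t + ε * m i t) t = deriv (pi i) t + ε * deriv (m i) t :=
        ((((hpi_diff i).differentiable one_ne_zero t).hasDerivAt).add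
          ((((hm_diff i).differentiable one_ne_zero t).hasDerivAt).const_mul ε)).deriv
      rw [h1]
      simp only [Finset.sum_add_distrib, ← Finset.mul_sum]
      have h2 := hpi_cont_eq i t
      have h3 := hm_cont_eq i t
      simp only [← Finset.mul_sum] at h2
      linear_combination h2 + ε * h3
    · have h1 : (fun t ↦ (∑ i, ∑ j, α i j t * (pi i t * w i j t + ε * R i j t))
          + ∑ i, γ i t * (pi i t + ε * m i t))
          = fun t ↦ ((∑ i, ∑ j, α i j t * (pi i t * w i j t)) + ∑ i, γ i t * pi i t)
            + ε * ((∑ i, ∑ j, α i j t * R i j t) + ∑ i, γ i t * m i t) := by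
        funext t
        simp only [mul_add, Finset.sum_add_distrib, Finset.mul_sum, mul_left_comm ε]
        ring
      rw [h1, intervalIntegral.integral_add, intervalIntegral.integral_const_mul]
      · linear_combination ε * h_norm - hy0
      · exact Continuous.intervalIntegrable (by fun_prop) _ _
      · exact Continuous.intervalIntegrable (by fun_prop) _ _
    · have hedge : ∀ e ∈ E, ENNReal.ofReal (1 / τ) * (∫⁻ t in Set.Ioc (0:ℝ) τ,
          Phi (pi e.1 t * w e.1 e.2 t + ε * R e.1 e.2 t)
            ((pi e.1 t + ε * m e.1 t) * w e.1 e.2 t))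
          ≤ ENNReal.ofReal (ε ^ 2 / (2 * (1 - C * |ε|)) * ((1 / τ) *
            ∫ t in (0:ℝ)..τ, g e t)) := by
        intro e he
        rw [mul_left_comm, ENNReal.ofReal_mul (by positivity),
          ← intervalIntegral.integral_const_mul, intervalIntegral.integral_of_le hτ.le,
          ofReal_integral_eq_lintegral_ofReal]
        · gcongr with t
          rw [add_mul, mul_assoc ε]
          exact Phi_perturb_le (ha e he t) (hRC e he t) (hmwC e he t) hε
        · exact (continuous_const.mul (hgc e he)).integrableOn_Ioc
        · exact ae_of_all _ fun t ↦ mul_nonneg (by positivity) (hg0 e he t)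
      refine (Finset.sum_le_sum hedge).trans_eq ?_
      rw [hS, Finset.mul_sum, ENNReal.ofReal_sum_of_nonneg]
      intro e he
      have := intervalIntegral.integral_nonneg (μ := volume) hτ.le fun t _ ↦ hg0 e he t
      positivity
  -- pass to the limit
  have hcont : ContinuousAt (fun y : ℝ ↦ C * |(y - y0) / y0|) y0 := by fun_prop
  have hev : ∀ᶠ y in 𝓝[≠] y0, C * |(y - y0) / y0| < 1 :=
    (hcont.eventually_lt continuousAt_const (by simp)).filter_mono nhdsWithin_le_nhds
  have hlim : Tendsto (fun y : ℝ ↦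
      ENNReal.ofReal (1 / (2 * y0 ^ 2 * (1 - C * |(y - y0) / y0|)) * S)) (𝓝[≠] y0)
      (𝓝 (ENNReal.ofReal (1 / (2 * y0 ^ 2) * S))) := by
    refine (ENNReal.tendsto_ofReal ?_).mono_left nhdsWithin_le_nhds
    have h : ContinuousAt
        (fun y : ℝ ↦ 1 / (2 * y0 ^ 2 * (1 - C * |(y - y0) / y0|)) * S) y0 :=
      ((continuousAt_const.div (continuousAt_const.mul (continuousAt_const.sub hcont))
        (by simp [hy0_ne]))).mul continuousAt_const
    simpa using h.tendsto
  rw [← hlim.limsup_eq]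
  refine limsup_le_limsup ?_
  filter_upwards [hev, self_mem_nhdsWithin] with y hy hne
  have hsub : y - y0 ≠ 0 := sub_ne_zero.2 hne
  have hd : 1 - C * |(y - y0) / y0| ≠ 0 := (sub_pos.2 hy).ne'
  have hb := hbound _ hy
  rw [div_mul_cancel₀ _ hy0_ne, add_sub_cancel] at hb
  refine (ENNReal.div_le_div_right hb _).trans_eq ?_
  rw [← ENNReal.ofReal_div_of_pos (by positivity)]
  congr 1
  rw [div_pow]
  field_simp
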